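/- Let $T_{q_0} = \langle X_n, Q, \pi, \lambda \rangle$ be an initial one-way synchronizing transducer representing a homeomorphism of $\mathfrak{C}_n$. Then $T_{q_0} V_n T_{q_0}^{-1}$ contains $V_n$, and so is an overgroup of $V_n$ inside the homeomorphism group of $\mathfrak{C}_n$. -/

import Mathlib

open Classical

noncomputable section

/-- `n`-ary Cantor space: infinite words over the alphabet `Fin n`. -/
abbrev Cantor (n : ℕ) : Type := ℕ → Fin n

/-- The finite word `w` is a prefix of the infinite word `χ`. -/
def PrefixOf {n : ℕ} (w : List (Fin n)) (χ : Cantor n) : Prop :=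
  ∀ (i : ℕ) (h : i < w.length), w.get ⟨i, h⟩ = χ i

/-- Concatenation of a finite word with an infinite word. -/
def appendInf {n : ℕ} (w : List (Fin n)) (χ : Cantor n) : Cantor n :=
  fun i => if h : i < w.length then w.get ⟨i, h⟩ else χ (i - w.length)

/-- The cone (basic clopen set) of infinite words having the finite word `w` as prefix. -/
def cone {n : ℕ} (w : List (Fin n)) : Set (Cantor n) :=
  {χ | PrefixOf w χ}

/-- The length-`k` prefix of an infinite word, as a finite word. -/
def takeW {n : ℕ} (χ : Cantor n) (k : ℕ) : List (Fin n) :=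
  List.ofFn (fun i : Fin k => χ i)

/-- A finite family of finite words forming a maximal antichain:
every infinite word has exactly one member of the family as a prefix. -/
def AntichainFam {n m : ℕ} (α : Fin m → List (Fin n)) : Prop :=
  ∀ χ : Cantor n, ∃! i : Fin m, PrefixOf (α i) χ

/-- The group structure on self-homeomorphisms of a topological space,
with `f * g` acting as `g` followed by `f`. -/
instance homeoGroup {X : Type*} [TopologicalSpace X] : Group (X ≃ₜ X) where
  mul f g := g.trans f
  one := Homeomorph.refl X
  inv := Homeomorph.symm
  mul_assoc a b c := Homeomorph.ext fun _ => rfl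
  one_mul a := Homeomorph.ext fun _ => rfl
  mul_one a := Homeomorph.ext fun _ => rfl
  inv_mul_cancel a := Homeomorph.ext fun x => a.symm_apply_apply x

/-- The Higman–Thompson group `Vₙ`, as the set of self-homeomorphisms of Cantor space
which act by exchanging finite prefixes along a pair of maximal antichains. -/
def Vn (n : ℕ) : Set (Cantor n ≃ₜ Cantor n) :=
  {g | ∃ (m : ℕ) (α β : Fin m → List (Fin n)), AntichainFam α ∧ AntichainFam β ∧
      ∀ (i : Fin m) (χ : Cantor n), g (appendInf (α i) χ) = appendInf (β i) χ}

/-- Conjugation in the paper's right-action convention: `paperConj g v = g⁻¹ v g`,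
i.e. the homeomorphism `x ↦ (x) g⁻¹ v g` (first apply `g⁻¹`, then `v`, then `g`). -/
def paperConj {n : ℕ} (g v : Cantor n ≃ₜ Cantor n) : Cantor n ≃ₜ Cantor n :=
  (g.symm.trans v).trans g

/-- `l` is the longest common prefix of the set `A` of infinite words. -/
def IsLCP {n : ℕ} (A : Set (Cantor n)) (l : List (Fin n)) : Prop :=
  (∀ ρ ∈ A, PrefixOf l ρ) ∧
    ∀ l' : List (Fin n), (∀ ρ ∈ A, PrefixOf l' ρ) → l'.length ≤ l.length

/-- A (not necessarily finite-state) transducer over the alphabet `Fin n`. -/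
structure Transducer (n : ℕ) where
  /-- the set of states -/
  Q : Type
  /-- the transition function -/
  tr : Fin n → Q → Q
  /-- the output (rewrite) function -/
  out : Fin n → Q → List (Fin n)

namespace Transducer

variable {n : ℕ}

/-- The transition function extended to finite words. -/
def transStar (T : Transducer n) : List (Fin n) → T.Q → T.Q
  | [], q => q
  | x :: w, q => T.transStar w (T.tr x q)

/-- The output function extended to finite words. -/
def outStar (T : Transducer n) : List (Fin n) → T.Q → List (Fin n)
  | [], _ => []
  | x :: w, q => T.out x q ++ T.outStar w (T.tr x q)

/-- The initial transducer `T_q` induces the map `f` on Cantor space: the outputs along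
ever longer prefixes of `χ` are ever longer prefixes of `f χ`. -/
def Induces (T : Transducer n) (q : T.Q) (f : Cantor n → Cantor n) : Prop :=
  ∀ (χ : Cantor n) (m : ℕ), ∃ k : ℕ,
    m ≤ (T.outStar (takeW χ k) q).length ∧ PrefixOf (T.outStar (takeW χ k) q) (f χ)

/-- The image of the state `q`: the image of Cantor space under the map induced by `T_q`. -/
def stateImage (T : Transducer n) (q : T.Q) : Set (Cantor n) :=
  {y | ∃ (f : Cantor n → Cantor n) (χ : Cantor n), T.Induces q f ∧ f χ = y}

/-- `T` is synchronizing at level `k`: the state reached after reading any word of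
length `k` does not depend on the starting state. -/
def SyncAtLevel (T : Transducer n) (k : ℕ) : Prop :=
  ∀ w : List (Fin n), w.length = k → ∀ q q' : T.Q, T.transStar w q = T.transStar w q'

/-- `T` is synchronizing if it is synchronizing at some level. -/
def Synchronizing (T : Transducer n) : Prop := ∃ k, T.SyncAtLevel k

/-- `T` (inducing the homeomorphism `h` at `q0`) is one-way synchronizing: `T` is
synchronizing, but the inverse homeomorphism is not induced by any finite
synchronizing transducer (equivalently, the inverse transducer is not synchronizing). -/
def OneWaySync (T : Transducer n) (q0 : T.Q) (h : Cantor n ≃ₜ Cantor n) : Prop :=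
  T.Induces q0 ⇑h ∧ T.Synchronizing ∧
    ¬ ∃ (S : Transducer n) (_ : Finite S.Q) (s0 : S.Q),
        S.Induces s0 ⇑h.symm ∧ S.Synchronizing

/-- `T` is equal to its core : every state is reached by reading a word of length `k`
from some state, for every synchronizing level `k`. -/
def EqualToCore (T : Transducer n) : Prop :=
  ∀ k : ℕ, T.SyncAtLevel k → ∀ q : T.Q, ∃ (w : List (Fin n)) (p : T.Q),
    w.length = k ∧ T.transStar w p = q

/-- Every state of `T` is accessible from `q0`. -/
def Accessible (T : Transducer n) (q0 : T.Q) : Prop :=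
  ∀ q : T.Q, ∃ w : List (Fin n), T.transStar w q0 = q

/-- The product transducer `T S` (first act by `T`, then by `S`). -/
def prod (T S : Transducer n) : Transducer n where
  Q := T.Q × S.Q
  tr := fun x p => (T.tr x p.1, S.transStar (T.out x p.1) p.2)
  out := fun x p => S.outStar (T.out x p.1) p.2

/-- `T` is partially invertible: every state induces an injective map on Cantor space
with clopen image. -/
def PartiallyInvertible (T : Transducer n) : Prop :=
  ∀ q : T.Q, ∃ f : Cantor n → Cantor n,
    T.Induces q f ∧ Function.Injective f ∧ IsClopen (Set.range f)

/-- `T` has no states of incomplete response: for each state `q` and letter `i`, no word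
strictly longer than `λ(i,q)` is a common prefix of the outputs on all of the cone `[i]`. -/
def NoIncompleteResponse (T : Transducer n) : Prop :=
  ∀ (q : T.Q) (i x : Fin n),
    ¬ ∀ χ : Cantor n, ∃ k : ℕ, (T.out i q ++ [x]) <+: T.outStar (i :: takeW χ k) q

/-- States `q` of `T` and `p` of `S` are `ω`-equivalent: they induce one and the same
map on Cantor space. -/
def OmegaEq (T : Transducer n) (q : T.Q) (S : Transducer n) (p : S.Q) : Prop :=
  ∃ f : Cantor n → Cantor n, T.Induces q f ∧ S.Induces p f

/-- `T` is minimal: no states of incomplete response and no pair of distinct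
`ω`-equivalent states. -/
def Minimal (T : Transducer n) : Prop :=
  T.NoIncompleteResponse ∧ ∀ q q' : T.Q, T.OmegaEq q T q' → q = q'

/-- The map on Cantor space induced by the state `q` (junk value if none exists). -/
def inducedMap (T : Transducer n) (q : T.Q) : Cantor n → Cantor n :=
  if h : ∃ f, T.Induces q f then h.choose else id

/-- `𝓛_q(α)`: the longest common prefix of the preimage of the cone `[α]` under `T_q`
(junk value if it does not exist). -/
def lcp (T : Transducer n) (q : T.Q) (α : List (Fin n)) : List (Fin n) :=
  if h : ∃ l, IsLCP {ρ : Cantor n | T.inducedMap q ρ ∈ cone α} l then h.choose else []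

/-- The inverse transducer of `T` given by the inversion algorithm, on the set of all
pairs `(w, q)`: reading `x` from `(w,q)` outputs `𝓛_q(wx)` and moves to
`(wx - λ(𝓛_q(wx), q), π(𝓛_q(wx), q))`. -/
def invT (T : Transducer n) : Transducer n where
  Q := List (Fin n) × T.Q
  tr := fun x p =>
    ((p.1 ++ [x]).drop (T.outStar (T.lcp p.2 (p.1 ++ [x])) p.2).length,
      T.transStar (T.lcp p.2 (p.1 ++ [x])) p.2)
  out := fun x p => T.lcp p.2 (p.1 ++ [x])

/-- Restriction of a transducer to a set of states (transitions leaving the set are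
replaced by junk loops; for transition-closed sets this is the honest restriction). -/
def restrictTo (T : Transducer n) (P : T.Q → Prop) : Transducer n where
  Q := {q : T.Q // P q}
  tr := fun x q => if h : P (T.tr x q.1) then ⟨T.tr x q.1, h⟩ else q
  out := fun x q => T.out x q.1

/-- The set of states reachable from `q0`. -/
def reach (T : Transducer n) (q0 : T.Q) : T.Q → Prop :=
  fun q => ∃ w : List (Fin n), T.transStar w q0 = q

/-- The inverse transducer of the initial transducer `T_{q0}`, with state set the states
accessible from `(ε, q0)`. -/
def invAcc (T : Transducer n) (q0 : T.Q) : Transducer n :=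
  (T.invT).restrictTo ((T.invT).reach ([], q0))

/-- A pair `(w,p)` is good if `[w] ⊆ im(T_p)` and `𝓛_p(w) = ε`. -/
def GoodPair (T : Transducer n) (p : List (Fin n) × T.Q) : Prop :=
  cone p.1 ⊆ T.stateImage p.2 ∧
    IsLCP {ρ : Cantor n | T.inducedMap p.2 ρ ∈ cone p.1} []

/-- The partial inverse `T'` of a partially invertible transducer `T`: the inverse
transducer restricted to the good pairs `(w,p)` with `[w] ⊆ im(T_p)`, `𝓛_p(w) = ε`. -/
def partialInv (T : Transducer n) : Transducer n :=
  (T.invT).restrictTo T.GoodPair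

/-- `h` is a completion of `T`: there are a maximal antichain `η` and an effective viable
combination `(ρ, p)` such that `h` maps `η_i χ` to `ρ_i (χ)T_{p_i}`. -/
def IsCompletion (T : Transducer n) (h : Cantor n ≃ₜ Cantor n) : Prop :=
  ∃ (l : ℕ) (η ρ : Fin l → List (Fin n)) (p : Fin l → T.Q)
      (f : Fin l → (Cantor n → Cantor n)),
    l % (n - 1) = 1 % (n - 1) ∧
    AntichainFam η ∧
    (∀ i, T.Induces (p i) (f i)) ∧
    (⋃ i, appendInf (ρ i) '' Set.range (f i)) = Set.univ ∧
    (∀ i j, i ≠ j →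
      Disjoint (appendInf (ρ i) '' Set.range (f i))
        (appendInf (ρ j) '' Set.range (f j))) ∧
    ∀ (i : Fin l) (χ : Cantor n), h (appendInf (η i) χ) = appendInf (ρ i) (f i χ)

/-- The group `𝓗(T)` generated by all completions of `T`. -/
def HGroup (T : Transducer n) : Subgroup (Cantor n ≃ₜ Cantor n) :=
  Subgroup.closure {h | T.IsCompletion h}

/-- The subgroup-generating equivalence relation induced by the automaton underlying a
transducer `A` with start state `a0` (by Lemma 4.1, two words are related iff the states
they reach are identified by the collapsing procedure, i.e. iff the reached states
transition identically on all sufficiently long words). -/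
def simA (A : Transducer n) (a0 : A.Q) (α β : List (Fin n)) : Prop :=
  ∃ i : ℕ, ∀ w : List (Fin n), w.length = i →
    A.transStar w (A.transStar α a0) = A.transStar w (A.transStar β a0)

/-- `if b then T else T'`. -/
def factor (T : Transducer n) (b : Bool) : Transducer n :=
  if b then T else T.partialInv

/-- The product of a nonempty list of factors, each equal to `T` or its partial
inverse `T'`; these products make up the set `Π(T)`. -/
def prodOf (T : Transducer n) : List Bool → Transducer n
  | [] => T
  | [b] => T.factor b
  | b :: c :: rest => (T.factor b).prod (T.prodOf (c :: rest))

/-- `T` is contracting: every state of every product of copies of `T` and `T'` is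
`ω`-equivalent to an initial transducer which, after reading some fixed length of input,
always acts as a state of `T`. -/
def Contracting (T : Transducer n) : Prop :=
  ∀ L : List Bool, L ≠ [] → ∀ q : (T.prodOf L).Q,
    ∃ (V : Transducer n) (p : V.Q) (f : Cantor n → Cantor n),
      (T.prodOf L).Induces q f ∧ V.Induces p f ∧
      ∃ j : ℕ, ∀ w : List (Fin n), w.length = j →
        ∃ (u : T.Q) (g : Cantor n → Cantor n),
          V.Induces (V.transStar w p) g ∧ T.Induces u g

end Transducer

/-- The element `v` of `Vₙ` preserves the relation `r` on nonempty finite words: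
whenever `v` replaces the prefix `α` by `β`, the words `α` and `β` are related. -/
def PreservesRel {n : ℕ} (r : List (Fin n) → List (Fin n) → Prop)
    (g : Cantor n ≃ₜ Cantor n) : Prop :=
  ∀ (α β : List (Fin n)), α ≠ [] → β ≠ [] →
    (∀ χ : Cantor n, g (appendInf α χ) = appendInf β χ) → r α β

/-- The subgroup `V_∼` of `Vₙ` generated by the prefix-exchange homeomorphisms
preserving the relation `r`. -/
def VSim (n : ℕ) (r : List (Fin n) → List (Fin n) → Prop) :
    Subgroup (Cantor n ≃ₜ Cantor n) :=
  Subgroup.closure {g | g ∈ Vn n ∧ PreservesRel r g}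

/-- `f` coincides with `g` on the cone `[α]` (conjugated into the cone) and is the
identity off the cone: the homeomorphism `[α]_g`. -/
def IsRestrTo {n : ℕ} (α : List (Fin n)) (g f : Cantor n ≃ₜ Cantor n) : Prop :=
  (∀ χ : Cantor n, f (appendInf α χ) = appendInf α (g χ)) ∧
  ∀ χ : Cantor n, ¬ PrefixOf α χ → f χ = χ

/-- The Nekrashevych group `Vₙ(G)`: the group generated by `Vₙ` together with all the
homeomorphisms `[α]_g` for `g ∈ G`. -/
def NekG (n : ℕ) (G : Subgroup (Cantor n ≃ₜ Cantor n)) :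
    Subgroup (Cantor n ≃ₜ Cantor n) :=
  Subgroup.closure (Vn n ∪ {f | ∃ (α : List (Fin n)) (g : Cantor n ≃ₜ Cantor n),
    g ∈ G ∧ IsRestrTo α g f})

/-- The homeomorphism `f` locally agrees with the set `G` of homeomorphisms. -/
def LocallyAgrees {n : ℕ} (G : Set (Cantor n ≃ₜ Cantor n))
    (f : Cantor n ≃ₜ Cantor n) : Prop :=
  ∀ x : Cantor n, ∃ U : Set (Cantor n), IsOpen U ∧ x ∈ U ∧
    ∃ g ∈ G, Set.EqOn ⇑f ⇑g U

/-- A finite synchronous invertible transducer over `Fin n`: each state rewrites single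
letters to single letters bijectively. -/
structure SyncTransducer (n : ℕ) where
  /-- the set of states -/
  Q : Type
  /-- there are finitely many states -/
  fin : Finite Q
  /-- the transition function -/
  tr : Fin n → Q → Q
  /-- the (single-letter) output function -/
  out : Fin n → Q → Fin n
  /-- each state rewrites letters bijectively -/
  bij : ∀ q : Q, Function.Bijective fun x => out x q

namespace SyncTransducer

variable {n : ℕ}

/-- The transition function extended to finite words. -/
def trStar (U : SyncTransducer n) : List (Fin n) → U.Q → U.Q
  | [], q => q
  | x :: w, q => U.trStar w (U.tr x q)

/-- The output function extended to finite words. -/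
def outWord (U : SyncTransducer n) : List (Fin n) → U.Q → List (Fin n)
  | [], _ => []
  | x :: w, q => U.out x q :: U.outWord w (U.tr x q)

/-- The map on Cantor space induced by the initial transducer `U_q`. -/
def applyFun (U : SyncTransducer n) (q : U.Q) (χ : Cantor n) : Cantor n :=
  fun i => U.out (χ i) (U.trStar (takeW χ i) q)

/-- The inverse transducer of a synchronous invertible transducer. -/
def inv (U : SyncTransducer n) : SyncTransducer n where
  Q := U.Q
  fin := U.fin
  tr := fun y q => U.tr ((Equiv.ofBijective _ (U.bij q)).symm y) q
  out := fun y q => (Equiv.ofBijective _ (U.bij q)).symm y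
  bij := fun q => (Equiv.ofBijective _ (U.bij q)).symm.bijective

/-- The product of synchronous transducers (first act by `T`, then by `S`). -/
def sprod (T S : SyncTransducer n) : SyncTransducer n where
  Q := T.Q × S.Q
  fin := by
    haveI := T.fin; haveI := S.fin
    infer_instance
  tr := fun x p => (T.tr x p.1, S.tr (T.out x p.1) p.2)
  out := fun x p => S.out (T.out x p.1) p.2
  bij := fun p => (S.bij p.2).comp (T.bij p.1)

/-- `U` is synchronizing at level `k`. -/
def SyncAtLevel (U : SyncTransducer n) (k : ℕ) : Prop :=
  ∀ w : List (Fin n), w.length = k → ∀ q q' : U.Q, U.trStar w q = U.trStar w q'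

/-- `U` is synchronizing. -/
def Synchronizing (U : SyncTransducer n) : Prop := ∃ k, U.SyncAtLevel k

/-- `U` is minimal (under `ω`-equivalence): distinct states induce distinct maps. -/
def Minimal (U : SyncTransducer n) : Prop :=
  ∀ q q' : U.Q, U.applyFun q = U.applyFun q' → q = q'

/-- One-way synchronizing: `U` is synchronizing but the inverse homeomorphism of
`h = U_{q0}` is not induced by any finite synchronizing transducer. -/
def OneWaySync (U : SyncTransducer n) (h : Cantor n ≃ₜ Cantor n) : Prop :=
  U.Synchronizing ∧
    ¬ ∃ (S : Transducer n) (_ : Finite S.Q) (s0 : S.Q),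
        S.Induces s0 ⇑h.symm ∧ S.Synchronizing

/-- `U` is equal to its core. -/
def EqualToCore (U : SyncTransducer n) : Prop :=
  ∀ k : ℕ, U.SyncAtLevel k → ∀ q : U.Q, ∃ (w : List (Fin n)) (p : U.Q),
    w.length = k ∧ U.trStar w p = q

/-- The underlying (asynchronous-format) transducer of a synchronous transducer. -/
def toT (U : SyncTransducer n) : Transducer n :=
  ⟨U.Q, U.tr, fun x q => [U.out x q]⟩

/-- The automaton group `𝒢(U)` generated by `U`: the subgroup of the homeomorphism
group of Cantor space generated by the homeomorphisms `U_q` for the states `q`. -/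
def autG (U : SyncTransducer n) : Subgroup (Cantor n ≃ₜ Cantor n) :=
  Subgroup.closure {f : Cantor n ≃ₜ Cantor n | ∃ q : U.Q, ⇑f = U.applyFun q}

end SyncTransducer

/-! ### Words and infinite words -/

lemma prefixOf_appendInf {n : ℕ} (w : List (Fin n)) (χ : Cantor n) :
    PrefixOf w (appendInf w χ) := by
  intro i hi
  simp [appendInf, hi]

lemma appendInf_append {n : ℕ} (u w : List (Fin n)) (χ : Cantor n) :
    appendInf (u ++ w) χ = appendInf u (appendInf w χ) := by
  funext i
  simp only [appendInf, List.length_append, List.get_eq_getElem]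
  by_cases h1 : i < u.length
  · simp [h1, List.getElem_append_left, Nat.lt_add_right]
  · by_cases h2 : i - u.length < w.length
    · have h3 : i < u.length + w.length := by omega
      simp [h1, h2, h3, List.getElem_append_right (Nat.le_of_not_lt h1)]
    · have h3 : ¬ i < u.length + w.length := by omega
      simp [h1, h2, h3, Nat.sub_sub]

lemma PrefixOf.exists_appendInf {n : ℕ} {w : List (Fin n)} {χ : Cantor n}
    (h : PrefixOf w χ) : ∃ ψ, χ = appendInf w ψ := by
  refine ⟨fun i => χ (i + w.length), ?_⟩
  funext i
  by_cases h1 : i < w.length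
  · simpa [appendInf, h1] using (h i h1).symm
  · simp [appendInf, h1, Nat.sub_add_cancel (Nat.le_of_not_lt h1)]

lemma appendInf_injective {n : ℕ} (w : List (Fin n)) :
    Function.Injective (appendInf w) := by
  intro χ ψ h
  funext i
  simpa [appendInf] using congrFun h (i + w.length)

lemma PrefixOf.of_append {n : ℕ} {a c : List (Fin n)} {z : Cantor n}
    (h : PrefixOf (a ++ c) (appendInf a z)) : PrefixOf c z := by
  obtain ⟨ψ, hψ⟩ := h.exists_appendInf
  rw [appendInf_append] at hψ
  rw [appendInf_injective a hψ]
  exact prefixOf_appendInf c ψ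

lemma PrefixOf.of_isPrefix {n : ℕ} {u w : List (Fin n)} {χ : Cantor n}
    (h : PrefixOf w χ) (huw : u <+: w) : PrefixOf u χ := by
  obtain ⟨t, rfl⟩ := huw
  obtain ⟨ψ, rfl⟩ := h.exists_appendInf
  rw [appendInf_append]
  exact prefixOf_appendInf u _

lemma PrefixOf.eq_of_length_eq {n : ℕ} {u w : List (Fin n)} {χ : Cantor n}
    (hu : PrefixOf u χ) (hw : PrefixOf w χ) (hl : u.length = w.length) : u = w :=
  List.ext_getElem hl fun i h1 h2 => (hu i h1).trans (hw i h2).symm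

@[simp] lemma length_takeW {n : ℕ} (χ : Cantor n) (k : ℕ) : (takeW χ k).length = k := by
  simp [takeW]

lemma prefixOf_takeW {n : ℕ} (χ : Cantor n) (k : ℕ) : PrefixOf (takeW χ k) χ := by
  intro i hi
  simp [takeW]

lemma takeW_eq {n : ℕ} {w : List (Fin n)} {χ : Cantor n} (h : PrefixOf w χ) :
    takeW χ w.length = w :=
  (prefixOf_takeW χ _).eq_of_length_eq h (by simp)

lemma PrefixOf.append {n : ℕ} {a c : List (Fin n)} {z : Cantor n} (h : PrefixOf c z) :
    PrefixOf (a ++ c) (appendInf a z) := by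
  obtain ⟨ψ, rfl⟩ := h.exists_appendInf
  rw [← appendInf_append]
  exact prefixOf_appendInf _ ψ

lemma takeW_appendInf {n : ℕ} (w : List (Fin n)) (χ : Cantor n) (k : ℕ) :
    takeW (appendInf w χ) (w.length + k) = w ++ takeW χ k := by
  simpa using takeW_eq ((prefixOf_takeW χ k).append (a := w))

lemma takeW_add {n : ℕ} (χ : Cantor n) (k l : ℕ) :
    ∃ t, takeW χ (k + l) = takeW χ k ++ t := by
  obtain ⟨ψ, hψ⟩ := (prefixOf_takeW χ k).exists_appendInf
  exact ⟨takeW ψ l, by simpa [← hψ] using takeW_appendInf (takeW χ k) ψ l⟩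

lemma eq_of_common_prefixes {n : ℕ} {z z' : Cantor n}
    (h : ∀ m : ℕ, ∃ c : List (Fin n), m ≤ c.length ∧ PrefixOf c z ∧ PrefixOf c z') :
    z = z' := by
  funext i
  obtain ⟨c, hc, h1, h2⟩ := h (i + 1)
  exact (h1 i hc).symm.trans (h2 i hc)

lemma takeW_congr {n : ℕ} {χ ψ : Cantor n} {k : ℕ} (h : ∀ i < k, χ i = ψ i) :
    takeW χ k = takeW ψ k := by
  simp only [takeW]
  congr 1
  funext i
  exact h i i.2

lemma isOpen_of_takeW {n : ℕ} {U : Set (Cantor n)} (k : ℕ)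
    (h : ∀ χ ∈ U, ∀ ψ, takeW ψ k = takeW χ k → ψ ∈ U) : IsOpen U := by
  rw [isOpen_pi_iff]
  intro χ hχ
  refine ⟨Finset.range k, fun i => {χ i}, fun i _ => ⟨isOpen_discrete _, rfl⟩, ?_⟩
  intro ψ hψ
  refine h χ hχ ψ (takeW_congr fun i hi => ?_)
  simpa using hψ i (by simpa using hi)

lemma isOpen_cone {n : ℕ} (w : List (Fin n)) : IsOpen (cone w) := by
  refine isOpen_of_takeW w.length fun χ hχ ψ hψ => ?_
  rw [takeW_eq hχ] at hψ
  have := prefixOf_takeW ψ w.length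
  rwa [hψ] at this

lemma exists_cone_subset {n : ℕ} {U : Set (Cantor n)} (hU : IsOpen U) {y : Cantor n}
    (hy : y ∈ U) (l : ℕ) : ∃ k, cone (takeW y (l + k)) ⊆ U := by
  obtain ⟨I, u, hu, hI⟩ := isOpen_pi_iff.1 hU y hy
  refine ⟨I.sup id + 1, fun ψ hψ => hI fun i hi => ?_⟩
  have hle : i ≤ I.sup id := Finset.le_sup (f := id) hi
  have h1 := hψ i (by simp; omega)
  have h2 := prefixOf_takeW y (l + (I.sup id + 1)) i (by simp; omega)
  rw [← h1, h2]
  exact (hu i hi).2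

/-! ### Recognising elements of `Vn` -/

/-- A homeomorphism which exchanges prefixes near every point lies in `Vn`. -/
lemma mem_Vn_of_locally {n : ℕ} (g : Cantor n ≃ₜ Cantor n)
    (hg : ∀ y : Cantor n, ∃ (k : ℕ) (b : List (Fin n)),
      ∀ χ, g (appendInf (takeW y k) χ) = appendInf b χ) : g ∈ Vn n := by
  let U : ℕ → Set (Cantor n) := fun k =>
    {y | ∃ b : List (Fin n), ∀ χ, g (appendInf (takeW y k) χ) = appendInf b χ}
  have hopen : ∀ k, IsOpen (U k) := fun k => isOpen_of_takeW k <| by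
    rintro χ ⟨b, hb⟩ ψ hψ
    exact ⟨b, by simpa only [hψ] using hb⟩
  have hmono : Monotone U := by
    intro k l hkl y
    rintro ⟨b, hb⟩
    obtain ⟨d, rfl⟩ := Nat.exists_eq_add_of_le hkl
    obtain ⟨t, ht⟩ := takeW_add y k d
    exact ⟨b ++ t, fun χ => by rw [ht, appendInf_append, hb, appendInf_append]⟩
  obtain ⟨N, hN⟩ := isCompact_univ.elim_directed_cover U hopen
    (fun y _ => Set.mem_iUnion.2 (hg y)) hmono.directed_le
  have key : ∀ w : Fin N → Fin n, ∃ b : List (Fin n),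
      ∀ χ, g (appendInf (List.ofFn w) χ) = appendInf b χ := by
    intro w
    by_cases hne : Nonempty (Cantor n)
    · obtain ⟨χ₀⟩ := hne
      obtain ⟨b, hb⟩ := hN (Set.mem_univ (appendInf (List.ofFn w) χ₀))
      have := takeW_eq (prefixOf_appendInf (List.ofFn w) χ₀)
      rw [List.length_ofFn] at this
      exact ⟨b, by simpa only [this] using hb⟩
    · exact ⟨[], fun χ => (hne ⟨χ⟩).elim⟩
  choose b hb using key
  let e := (Fintype.equivFin (Fin N → Fin n)).symm
  have hα : AntichainFam fun i => List.ofFn (e i) := by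
    intro χ
    refine ⟨e.symm fun i => χ i, by simpa [takeW] using prefixOf_takeW χ N, fun j hj => ?_⟩
    have := hj.eq_of_length_eq (prefixOf_takeW χ N) (by simp)
    rw [Equiv.eq_symm_apply]
    exact List.ofFn_injective this
  refine ⟨_, fun i => List.ofFn (e i), fun i => b (e i), hα, fun χ => ?_, fun i χ => hb _ χ⟩
  obtain ⟨i, hi, huniq⟩ := hα (g.symm χ)
  refine ⟨i, ?_, fun j hj => huniq j ?_⟩
  · obtain ⟨ψ, hψ⟩ := PrefixOf.exists_appendInf hi
    have : χ = appendInf (b (e i)) ψ := by rw [← hb, ← hψ, g.apply_symm_apply]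
    rw [this]
    exact prefixOf_appendInf _ _
  · obtain ⟨ψ, hψ⟩ := PrefixOf.exists_appendInf hj
    have : g.symm χ = appendInf (List.ofFn (e j)) ψ := by
      rw [hψ, ← hb, g.symm_apply_apply]
    simp only [this]
    exact prefixOf_appendInf _ _

/-! ### Maps induced by transducers -/

namespace Transducer

lemma transStar_append {n : ℕ} (T : Transducer n) (u w : List (Fin n)) (q : T.Q) :
    T.transStar (u ++ w) q = T.transStar w (T.transStar u q) := by
  induction u generalizing q with
  | nil => rfl
  | cons x u ih => exact ih _

lemma outStar_append {n : ℕ} (T : Transducer n) (u w : List (Fin n)) (q : T.Q) :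
    T.outStar (u ++ w) q = T.outStar u q ++ T.outStar w (T.transStar u q) := by
  induction u generalizing q with
  | nil => rfl
  | cons x u ih => simp [outStar, transStar, ih]

lemma outStar_takeW_isPrefix {n : ℕ} (T : Transducer n) (q : T.Q) (χ : Cantor n)
    {k l : ℕ} (h : k ≤ l) : T.outStar (takeW χ k) q <+: T.outStar (takeW χ l) q := by
  obtain ⟨d, rfl⟩ := Nat.exists_eq_add_of_le h
  obtain ⟨t, ht⟩ := takeW_add χ k d
  rw [ht, outStar_append]
  exact List.prefix_append _ _

lemma Induces.prefixOf_outStar {n : ℕ} {T : Transducer n} {q : T.Q}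
    {f : Cantor n → Cantor n} (hf : T.Induces q f) (χ : Cantor n) (k : ℕ) :
    PrefixOf (T.outStar (takeW χ k) q) (f χ) := by
  obtain ⟨l, hl, hp⟩ := hf χ (T.outStar (takeW χ k) q).length
  rcases le_total k l with h | h
  · exact hp.of_isPrefix (T.outStar_takeW_isPrefix q χ h)
  · rwa [← (T.outStar_takeW_isPrefix q χ h).eq_of_length_le hl]

lemma Induces.prefixOf_outStar_append {n : ℕ} {T : Transducer n} {q : T.Q}
    {f : Cantor n → Cantor n} (hf : T.Induces q f) (u : List (Fin n)) (δ : Cantor n)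
    (k : ℕ) : PrefixOf (T.outStar u q ++ T.outStar (takeW δ k) (T.transStar u q))
      (f (appendInf u δ)) := by
  rw [← outStar_append, ← takeW_appendInf]
  exact hf.prefixOf_outStar _ _

/-- If two words lead to the same state, then the images of their common continuations
differ only in the finite outputs produced along the two words. -/
lemma Induces.exists_common_tail {n : ℕ} {T : Transducer n} {q : T.Q}
    {f : Cantor n → Cantor n} (hf : T.Induces q f) {u u' : List (Fin n)}
    (huu : T.transStar u q = T.transStar u' q) (δ : Cantor n) :
    ∃ z, f (appendInf u δ) = appendInf (T.outStar u q) z ∧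
      f (appendInf u' δ) = appendInf (T.outStar u' q) z := by
  obtain ⟨z, hz⟩ := ((hf.prefixOf_outStar_append u δ 0).of_isPrefix
    (List.prefix_append _ _)).exists_appendInf
  obtain ⟨z', hz'⟩ := ((hf.prefixOf_outStar_append u' δ 0).of_isPrefix
    (List.prefix_append _ _)).exists_appendInf
  refine ⟨z, hz, ?_⟩
  suffices z = z' by rw [this, hz']
  refine eq_of_common_prefixes fun m => ?_
  obtain ⟨k, hk, -⟩ := hf (appendInf u δ) ((T.outStar u q).length + m)
  have hlen := hk.trans (T.outStar_takeW_isPrefix q (appendInf u δ)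
    (Nat.le_add_left k u.length)).length_le
  rw [takeW_appendInf, outStar_append, List.length_append] at hlen
  have h1 := hf.prefixOf_outStar_append u δ k
  have h2 := hf.prefixOf_outStar_append u' δ k
  rw [hz] at h1
  rw [hz', ← huu] at h2
  exact ⟨_, by omega, h1.of_append, h2.of_append⟩

/-- Conjugating an element of `Vn` by a homeomorphism induced by a synchronizing
transducer gives an element of `Vn`. -/
lemma Induces.paperConj_mem_Vn {n : ℕ} {T : Transducer n} {q : T.Q}
    {h : Cantor n ≃ₜ Cantor n} (hh : T.Induces q h) (hs : T.Synchronizing)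
    {v : Cantor n ≃ₜ Cantor n} (hv : v ∈ Vn n) : paperConj h v ∈ Vn n := by
  obtain ⟨k, hk⟩ := hs
  obtain ⟨m, α, β, hα, -, hv⟩ := hv
  refine mem_Vn_of_locally _ fun y => ?_
  obtain ⟨i, hi, -⟩ := hα (h.symm y)
  obtain ⟨ρ, hρ⟩ := PrefixOf.exists_appendInf hi
  set γ := takeW ρ k
  have hstate : T.transStar (α i ++ γ) q = T.transStar (β i ++ γ) q := by
    rw [transStar_append, transStar_append]
    exact hk _ (length_takeW ρ k) _ _
  have hy : h.symm y ∈ cone (α i ++ γ) := by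
    rw [hρ]
    exact (prefixOf_takeW ρ k).append
  set a := T.outStar (α i ++ γ) q
  have hay : PrefixOf a y := by
    obtain ⟨δ, hδ⟩ := PrefixOf.exists_appendInf hy
    obtain ⟨z, hz, -⟩ := hh.exists_common_tail hstate δ
    rw [← hδ, h.apply_symm_apply] at hz
    rw [hz]
    exact prefixOf_appendInf a z
  obtain ⟨l, hl⟩ := exists_cone_subset ((isOpen_cone (α i ++ γ)).preimage h.symm.continuous)
    hy a.length
  obtain ⟨t, ht⟩ := takeW_add y a.length l
  rw [takeW_eq hay] at ht
  refine ⟨a.length + l, T.outStar (β i ++ γ) q ++ t, fun χ => ?_⟩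
  obtain ⟨δ, hδ⟩ := PrefixOf.exists_appendInf
    (hl (prefixOf_appendInf (takeW y (a.length + l)) χ))
  obtain ⟨z, hz, hz'⟩ := hh.exists_common_tail hstate δ
  rw [← hδ, h.apply_symm_apply, ht, appendInf_append] at hz
  rw [appendInf_append, appendInf_injective _ hz, ← hz', appendInf_append (β i), ← hv,
    ← appendInf_append, ← hδ]
  rfl

end Transducer

/-- Corollary 2.3. For an initial one-way synchronizing transducer
`T_{q0}` representing a homeomorphism of Cantor space, `T_{q0} Vₙ T_{q0}⁻¹` contains
`Vₙ`, and so is an overgroup of `Vₙ`. -/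
theorem Vn_subset_conj_by_inverse_of_one_way_synchronizing
    {n : ℕ} (hn : 2 ≤ n) (T : Transducer n) [Finite T.Q] (q0 : T.Q)
    (h : Cantor n ≃ₜ Cantor n) (hOne : T.OneWaySync q0 h) :
    Vn n ⊆ paperConj h.symm '' Vn n := by
  intro v hv
  refine ⟨paperConj h v, hOne.1.paperConj_mem_Vn hOne.2.1 hv, ?_⟩
  ext χ : 1
  simp [paperConj]
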